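/- arXiv:math/9908170 — 4 statements merged into one kernel-verified Lean document; each statement's English description precedes it below -/
import Mathlib

section
/- For every positive integer n, every partition of the edges of the complete graph K_n into two color classes (red and blue) contains a monochromatic diameter-two subgraph on at least ⌈3n/4⌉ vertices. -/
/-- `A` is the vertex set of a monochromatic diameter-two subgraph in color `col`
(`true` = red, `false` = blue) of the complete graph on `Fin n` whose edges are
two-colored by `c`. -/
def MonoDiamTwo {n : ℕ} (c : Fin n → Fin n → Bool) (col : Bool)
    (A : Finset (Fin n)) : Prop :=
  ∀ x ∈ A, ∀ y ∈ A, x = y ∨ c x y = col ∨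
    ∃ z ∈ A, z ≠ x ∧ z ≠ y ∧ c x z = col ∧ c z y = col

namespace SimpleGraph

variable {V : Type*}

/-- Two distinct vertices at distance greater than two. -/
def Far (G : SimpleGraph V) (x y : V) : Prop :=
  x ≠ y ∧ ¬ G.Adj x y ∧ ∀ z, G.Adj x z → ¬ G.Adj z y

/-- Every two vertices of `A` are at distance at most two in the subgraph induced on `A`. -/
def DiamTwoOn (G : SimpleGraph V) (A : Finset V) : Prop :=
  ∀ x ∈ A, ∀ y ∈ A, x = y ∨ G.Adj x y ∨ ∃ z ∈ A, G.Adj x z ∧ G.Adj z y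

/-- The least set of non-neighbours of `u` whose deletion leaves no vertex `q` not adjacent to `u`
and vertex `p` not adjacent to `v` at distance greater than two.  Here `H` plays the role of the
complement of `G`. -/
inductive Removed (G H : SimpleGraph V) (u v : V) : V → Prop
  | intro (p q : V) : H.Adj q u → H.Adj p v → H.Adj p q →
      (∀ z, G.Adj p z → G.Adj z q → Removed G H u v z) → Removed G H u v q

variable {R B : SimpleGraph V}

lemma Far.symm {x y : V} (h : R.Far x y) : R.Far y x :=
  ⟨h.1.symm, fun e => h.2.1 e.symm, fun z h₁ h₂ => h.2.2 z h₂.symm h₁.symm⟩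

lemma adj_or_adj_of_isCompl (h : IsCompl R B) {x y : V} (hxy : x ≠ y) :
    R.Adj x y ∨ B.Adj x y := by
  have : (R ⊔ B).Adj x y := by rw [h.sup_eq_top]; exact hxy
  exact this

lemma not_adj_of_isCompl (h : IsCompl R B) {x y : V} (hR : R.Adj x y) : ¬ B.Adj x y := by
  intro hB
  have : (R ⊓ B).Adj x y := ⟨hR, hB⟩
  rw [h.inf_eq_bot] at this
  exact this

lemma Removed.adj {u v q : V} (h : Removed R B u v q) : B.Adj q u := by
  cases h; assumption

lemma Far.not_adj_of_adj {u v z : V} (h : B.Far u v) (hz : B.Adj z u) : ¬ B.Adj z v :=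
  h.2.2 z hz.symm

lemma Far.adj_of_isCompl (h : IsCompl R B) {u v : V} (huv : B.Far u v) : R.Adj u v :=
  (adj_or_adj_of_isCompl h huv.1).resolve_right huv.2.1

/-- Deleting the removed set leaves a graph of diameter two. -/
lemma diamTwoOn_of_removed (h : IsCompl R B) {u v : V} (huv : B.Far u v) (A : Finset V)
    (hA : ∀ z, z ∈ A ↔ ¬ Removed R B u v z) : R.DiamTwoOn A := by
  have hR := huv.adj_of_isCompl h
  have huA : u ∈ A := (hA u).2 fun h' => h'.adj.ne rfl
  have hvA : v ∈ A := (hA v).2 fun h' => huv.2.1 h'.adj.symm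
  have key : ∀ p ∈ A, ∀ q ∈ A, B.Adj q u → B.Adj p v → p = q ∨ R.Adj p q ∨
      ∃ z ∈ A, R.Adj p z ∧ R.Adj z q := by
    intro p hp q hq hqu hpv
    by_contra! hcon
    obtain ⟨hne, hnadj, hz⟩ := hcon
    refine (hA q).1 hq (.intro p q hqu hpv
      ((adj_or_adj_of_isCompl h hne).resolve_left hnadj) fun z hpz hzq => ?_)
    by_contra hrem
    exact hz z ((hA z).2 hrem) hpz hzq
  intro p hp q hq
  have hor := fun {x y : V} => adj_or_adj_of_isCompl h (x := x) (y := y)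
  by_cases hpu : B.Adj p u
  · have hpv : R.Adj p v := by
      by_cases e : p = v
      · exact absurd (e ▸ hpu.symm) huv.2.1
      · exact (hor e).resolve_right (huv.not_adj_of_adj hpu)
    by_cases hqv : B.Adj q v
    · rcases key q hq p hp hpu hqv with e | e | ⟨z, hzA, h₁, h₂⟩
      · exact .inl e.symm
      · exact .inr (.inl e.symm)
      · exact .inr (.inr ⟨z, hzA, h₂.symm, h₁.symm⟩)
    · by_cases e : q = v
      · exact .inr (.inl (e ▸ hpv))
      · exact .inr (.inr ⟨v, hvA, hpv, ((hor e).resolve_right hqv).symm⟩)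
  · by_cases hqu : B.Adj q u
    · by_cases hpv : B.Adj p v
      · exact key p hp q hq hqu hpv
      · have hqv : R.Adj q v := by
          by_cases e : q = v
          · exact absurd (e ▸ hqu.symm) huv.2.1
          · exact (hor e).resolve_right (huv.not_adj_of_adj hqu)
        by_cases e : p = v
        · exact .inr (.inl (e ▸ hqv.symm))
        · exact .inr (.inr ⟨v, hvA, (hor e).resolve_right hpv, hqv.symm⟩)
    · by_cases e : p = u
      · by_cases e' : q = u
        · exact .inl (e.trans e'.symm)
        · exact .inr (.inl (e ▸ ((hor e').resolve_right hqu).symm))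
      · have hpu' := (hor e).resolve_right hpu
        by_cases e' : q = u
        · exact .inr (.inl (e' ▸ hpu'))
        · exact .inr (.inr ⟨u, huA, hpu', ((hor e').resolve_right hqu).symm⟩)

lemma not_removed_descent (h : IsCompl R B) {x y u v : V} (hxy : R.Far x y) (huv : B.Far u v)
    {a : V} (ha : Removed R B u v a) : ∀ p, B.Adj p v → R.Adj a p → R.Adj a y →
      (∀ z, B.Adj a z → B.Adj z p → Removed B R x y z) → False := by
  induction ha with
  | intro p' a hau hpv' hpa' hrem ih =>
    intro p hpv hap hay hY
    have hne : p' ≠ p := by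
      rintro rfl
      exact not_adj_of_isCompl h hap hpa'.symm
    rcases adj_or_adj_of_isCompl h hne with hpp | hpp
    · exact huv.not_adj_of_adj (hrem p hpp hap.symm).adj hpv
    obtain ⟨b, _, _, hby, hbp', hYb⟩ := hY p' hpa'.symm hpp
    have hne' : a ≠ b := by
      rintro rfl
      exact not_adj_of_isCompl h hbp' hpa'.symm
    rcases adj_or_adj_of_isCompl h hne' with hab | hab
    · exact ih b hbp'.symm hab.symm p' hpv' hbp' hby hYb
    · exact hxy.not_adj_of_adj (hYb a hab.symm hpa'.symm).adj hay

lemma Removed.not_removed (h : IsCompl R B) {x y u v : V} (hxy : R.Far x y) (huv : B.Far u v)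
    (hux : B.Adj u x) {q : V} (hq : Removed B R x y q) : ¬ Removed R B u v q := by
  suffices H : ¬ Removed R B u v q ∧ (B.Adj q v → ∀ r, B.Adj r u → B.Adj q r →
      ¬ ∀ z, R.Adj q z → R.Adj z r → Removed R B u v z) from H.1
  induction hq with
  | intro a q hqx hay haq hY ih =>
    constructor
    · rintro ⟨p, _, hqu, hpv, hpq, hX⟩
      have hne : p ≠ a := by
        rintro rfl
        exact not_adj_of_isCompl h haq hpq
      rcases adj_or_adj_of_isCompl h hne with hpa | hpa
      · have hau := (hX a hpa haq).adj
        exact not_adj_of_isCompl h (hY u hau hqu.symm).adj hux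
      · exact (ih p hpa.symm hpq).2 hpv q hqu hpq hX
    · intro hqv r hru hqr hX
      have hne : a ≠ r := by
        rintro rfl
        exact not_adj_of_isCompl h haq hqr.symm
      rcases adj_or_adj_of_isCompl h hne with har | har
      · exact not_removed_descent h hxy huv (hX a haq.symm har) q hqv haq hay hY
      · exact (ih r har hqr.symm).1 (.intro q r hru hqv hqr hX)

/-- A far pair of a graph and a far pair of its complement span a path on four vertices. -/
lemma Far.cross (h : IsCompl R B) {x y u v : V} (hxy : R.Far x y) (huv : B.Far u v) :
    (B.Adj u x ∧ R.Adj u y ∧ R.Adj v x ∧ B.Adj v y) ∨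
    (B.Adj u y ∧ R.Adj u x ∧ R.Adj v y ∧ B.Adj v x) := by
  have hor := fun x y : V => adj_or_adj_of_isCompl h (x := x) (y := y)
  have hno := fun x y : V => not_adj_of_isCompl h (x := x) (y := y)
  have hr := huv.adj_of_isCompl h
  have hb := hxy.adj_of_isCompl h.symm
  have hrs := fun x y : V => R.adj_comm x y
  have hbs := fun x y : V => B.adj_comm x y
  obtain ⟨h₁, h₂, h₃⟩ := hxy
  obtain ⟨h₄, h₅, h₆⟩ := huv
  have e₁ : u ≠ x := by rintro rfl; grind
  have e₂ : u ≠ y := by rintro rfl; grind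
  have e₃ : v ≠ x := by rintro rfl; grind
  have e₄ : v ≠ y := by rintro rfl; grind
  grind

open Finset in
lemma exists_diamTwoOn_of_far [Fintype V] (h : IsCompl R B) {x y u v : V} (hxy : R.Far x y)
    (huv : B.Far u v) : ∃ A : Finset V, (R.DiamTwoOn A ∨ B.DiamTwoOn A) ∧
      3 * Fintype.card V ≤ 4 * #A := by
  classical
  wlog hc : B.Adj u x ∧ R.Adj u y ∧ R.Adj v x ∧ B.Adj v y generalizing x y
  · exact this hxy.symm ((hxy.cross h huv).resolve_left hc)
  obtain ⟨hux, huy, hvx, hvy⟩ := hc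
  let X₁ := univ.filter (Removed R B u v)
  let X₂ := univ.filter (Removed R B v u)
  let Y₁ := univ.filter (Removed B R x y)
  let Y₂ := univ.filter (Removed B R y x)
  have hX : Disjoint X₁ X₂ := disjoint_filter.2 fun q _ h₁ h₂ => huv.not_adj_of_adj h₁.adj h₂.adj
  have hY : Disjoint Y₁ Y₂ := disjoint_filter.2 fun q _ h₁ h₂ => hxy.not_adj_of_adj h₁.adj h₂.adj
  have hXY : Disjoint (X₁ ∪ X₂) (Y₁ ∪ Y₂) := by
    simp only [disjoint_union_left, disjoint_union_right]
    refine ⟨⟨?_, ?_⟩, ?_, ?_⟩ <;> refine disjoint_filter.2 fun q _ h₁ h₂ => ?_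
    · exact h₂.not_removed h hxy huv hux h₁
    · exact h₁.not_removed h.symm huv.symm hxy hvx.symm h₂
    · exact h₁.not_removed h.symm huv hxy.symm huy.symm h₂
    · exact h₂.not_removed h hxy.symm huv.symm hvy h₁
  have hcard := card_le_univ ((X₁ ∪ X₂) ∪ (Y₁ ∪ Y₂))
  rw [card_union_of_disjoint hXY, card_union_of_disjoint hX, card_union_of_disjoint hY] at hcard
  have hcompl (X : Finset V) : #X + #Xᶜ = Fintype.card V := card_add_card_compl X
  have hcases : 4 * #X₁ ≤ Fintype.card V ∨ 4 * #X₂ ≤ Fintype.card V ∨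
      4 * #Y₁ ≤ Fintype.card V ∨ 4 * #Y₂ ≤ Fintype.card V := by omega
  rcases hcases with hs | hs | hs | hs
  · exact ⟨X₁ᶜ, .inl (diamTwoOn_of_removed h huv _ (by simp [X₁])), by grind⟩
  · exact ⟨X₂ᶜ, .inl (diamTwoOn_of_removed h huv.symm _ (by simp [X₂])), by grind⟩
  · exact ⟨Y₁ᶜ, .inr (diamTwoOn_of_removed h.symm hxy _ (by simp [Y₁])), by grind⟩
  · exact ⟨Y₂ᶜ, .inr (diamTwoOn_of_removed h.symm hxy.symm _ (by simp [Y₂])), by grind⟩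

lemma diamTwoOn_univ_of_not_far [Fintype V] {G : SimpleGraph V} (h : ∀ x y, ¬ G.Far x y) :
    G.DiamTwoOn Finset.univ := by
  intro x _ y _
  by_contra! hcon
  exact h x y ⟨hcon.1, hcon.2.1, fun z h₁ h₂ => hcon.2.2 z (Finset.mem_univ z) h₁ h₂⟩

open Finset in
/-- A graph or its complement contains a diameter-two induced subgraph on at least three quarters
of the vertices. -/
lemma exists_diamTwoOn [Fintype V] (h : IsCompl R B) :
    ∃ A : Finset V, (R.DiamTwoOn A ∨ B.DiamTwoOn A) ∧ 3 * Fintype.card V ≤ 4 * #A := by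
  by_cases hR : ∀ x y, ¬ R.Far x y
  · exact ⟨univ, .inl (diamTwoOn_univ_of_not_far hR), by rw [card_univ]; omega⟩
  by_cases hB : ∀ x y, ¬ B.Far x y
  · exact ⟨univ, .inr (diamTwoOn_univ_of_not_far hB), by rw [card_univ]; omega⟩
  push Not at hR hB
  obtain ⟨x, y, hxy⟩ := hR
  obtain ⟨u, v, huv⟩ := hB
  exact exists_diamTwoOn_of_far h hxy huv

/-- The graph of the edges of color `col`. -/
def ofColor (c : V → V → Bool) (hc : ∀ x y, c x y = c y x) (col : Bool) : SimpleGraph V where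
  Adj x y := x ≠ y ∧ c x y = col
  symm := ⟨fun x y h => ⟨h.1.symm, hc y x ▸ h.2⟩⟩
  loopless := ⟨fun _ h => h.1 rfl⟩

lemma isCompl_ofColor (c : V → V → Bool) (hc : ∀ x y, c x y = c y x) :
    IsCompl (ofColor c hc true) (ofColor c hc false) := by
  refine IsCompl.of_eq ?_ ?_ <;> ext x y <;> cases hxy : c x y <;> simp [ofColor, hxy]

lemma DiamTwoOn.monoDiamTwo {n : ℕ} {c : Fin n → Fin n → Bool} {hc : ∀ x y, c x y = c y x}
    {col : Bool} {A : Finset (Fin n)} (h : (ofColor c hc col).DiamTwoOn A) :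
    MonoDiamTwo c col A := by
  intro x hx y hy
  rcases h x hx y hy with e | e | ⟨z, hz, h₁, h₂⟩
  · exact .inl e
  · exact .inr (.inl e.2)
  · exact .inr (.inr ⟨z, hz, h₁.1.symm, h₂.1, h₁.2, h₂.2⟩)

end SimpleGraph

/-- Every two-coloring (red/blue) of the edges of `K_n` contains a monochromatic
diameter-two subgraph on at least `⌈3n/4⌉` vertices. -/
theorem stmt1 (n : ℕ) (hn : 1 ≤ n)
    (c : Fin n → Fin n → Bool) (hc : ∀ x y, c x y = c y x) :
    ∃ (col : Bool) (A : Finset (Fin n)), MonoDiamTwo c col A ∧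
      ⌈(3 * (n : ℚ)) / 4⌉ ≤ (A.card : ℤ) := by
  obtain ⟨A, hA, hcard⟩ := SimpleGraph.exists_diamTwoOn (SimpleGraph.isCompl_ofColor c hc)
  rw [Fintype.card_fin] at hcard
  have hceil : ⌈(3 * (n : ℚ)) / 4⌉ ≤ (A.card : ℤ) := by
    rw [Int.ceil_le]
    have : (3 * n : ℚ) ≤ 4 * A.card := by exact_mod_cast hcard
    push_cast
    linarith
  rcases hA with hA | hA
  · exact ⟨true, A, hA.monoDiamTwo, hceil⟩
  · exact ⟨false, A, hA.monoDiamTwo, hceil⟩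
end

section
/- For every positive integer n, there exists a partition of the edges of the complete graph K_n into two color classes (red and blue) such that every monochromatic diameter-two subgraph contains at most ⌈3n/4⌉ vertices. Specifically, partition the vertices into four sets R1, R2, B1, B2 each of size ⌊n/4⌋ or ⌈n/4⌉; color an edge red if it joins R1 to B1, or B1 to B2, or B2 to R2, and blue otherwise; then every monochromatic diameter-two subgraph is disjoint from one of R1, R2, B1, B2. -/
theorem count_mod_four_eq {r : ℕ} (hr : r < 4) (n : ℕ) :
    Nat.count (fun k => k % 4 = r) n = (n + 3 - r) / 4 := by
  induction n with
  | zero => simp only [Nat.count_zero]; omega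
  | succ n ih => rw [Nat.count_succ, ih]; split_ifs <;> omega

/-- The vertices of `K_n` whose index is congruent to `r` modulo four. -/
def residueClass (n r : ℕ) : Finset (Fin n) :=
  Finset.univ.filter fun x => x.val % 4 = r

theorem mem_residueClass {n r : ℕ} {x : Fin n} : x ∈ residueClass n r ↔ x.val % 4 = r := by
  simp [residueClass]

theorem card_residueClass {r : ℕ} (hr : r < 4) (n : ℕ) :
    (residueClass n r).card = (n + 3 - r) / 4 := by
  rw [← count_mod_four_eq hr, Nat.count_eq_card_filter_range,
    ← Finset.card_map Fin.valEmbedding]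
  congr 1
  ext k
  simp only [Finset.mem_map, mem_residueClass, Finset.mem_filter, Finset.mem_range]
  exact ⟨by rintro ⟨x, hx, rfl⟩; exact ⟨x.isLt, hx⟩, fun ⟨hk, h⟩ => ⟨⟨k, hk⟩, h, rfl⟩⟩

theorem disjoint_residueClass {n r s : ℕ} (h : r ≠ s) :
    Disjoint (residueClass n r) (residueClass n s) := by
  rw [Finset.disjoint_left]
  intro x hr hs
  rw [mem_residueClass] at hr hs
  exact h (hr.symm.trans hs)

/-- An edge is red when its endpoints lie in residue classes modulo four that are adjacent on the
path `0, 1, 2, 3`. -/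
def pathColoring (n : ℕ) (x y : Fin n) : Bool :=
  decide (x.val % 4 + 1 = y.val % 4 ∨ y.val % 4 + 1 = x.val % 4)

theorem MonoDiamTwo.exists_inter_residueClass_eq_empty {n : ℕ} {col : Bool}
    {A : Finset (Fin n)} (hA : MonoDiamTwo (pathColoring n) col A) :
    ∃ r < 4, A ∩ residueClass n r = ∅ := by
  by_contra! h
  have hmem (r : ℕ) (hr : r < 4) : ∃ x ∈ A, x.val % 4 = r := by
    obtain ⟨x, hx⟩ := h r hr
    rw [Finset.mem_inter, mem_residueClass] at hx
    exact ⟨x, hx⟩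
  cases col with
  | true =>
    obtain ⟨x, hx, hx'⟩ := hmem 0 (by norm_num)
    obtain ⟨y, hy, hy'⟩ := hmem 3 (by norm_num)
    rcases hA x hx y hy with rfl | h | ⟨z, -, -, -, h₁, h₂⟩
    · omega
    · simp only [pathColoring, decide_eq_true_eq] at h
      omega
    · simp only [pathColoring, decide_eq_true_eq] at h₁ h₂
      omega
  | false =>
    obtain ⟨x, hx, hx'⟩ := hmem 1 (by norm_num)
    obtain ⟨y, hy, hy'⟩ := hmem 2 (by norm_num)
    rcases hA x hx y hy with rfl | h | ⟨z, -, -, -, h₁, h₂⟩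
    · omega
    · simp only [pathColoring, decide_eq_false_iff_not] at h
      omega
    · simp only [pathColoring, decide_eq_false_iff_not] at h₁ h₂
      omega

theorem card_le_ceil_of_inter_residueClass_eq_empty {n r : ℕ} (hr : r < 4)
    {A : Finset (Fin n)} (h : A ∩ residueClass n r = ∅) :
    (A.card : ℤ) ≤ ⌈(3 * (n : ℚ)) / 4⌉ := by
  have hcard : A.card + (n + 3 - r) / 4 ≤ n := by
    rw [← card_residueClass hr, ← Finset.card_union_of_disjoint
      (Finset.disjoint_iff_inter_eq_empty.2 h)]
    simpa using Finset.card_le_univ (A ∪ residueClass n r)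
  have hceil : 3 * (n : ℤ) ≤ 4 * ⌈(3 * (n : ℚ)) / 4⌉ := by
    have := Int.le_ceil ((3 * (n : ℚ)) / 4)
    have : 3 * (n : ℚ) ≤ 4 * (⌈(3 * (n : ℚ)) / 4⌉ : ℤ) := by linarith
    exact_mod_cast this
  omega

/-- There is a red/blue coloring of the edges of `K_n` whose monochromatic diameter-two
subgraphs all have at most `⌈3n/4⌉` vertices: partition the vertices into four sets
`R1, R2, B1, B2` of size `⌊n/4⌋` or `⌈n/4⌉`, color an edge red iff it joins `R1` to `B1`,
`B1` to `B2`, or `B2` to `R2`; then every monochromatic diameter-two subgraph is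
disjoint from one of `R1, R2, B1, B2`. -/
theorem stmt2 (n : ℕ) (hn : 1 ≤ n) :
    ∃ (c : Fin n → Fin n → Bool) (R1 R2 B1 B2 : Finset (Fin n)),
      (∀ x y, c x y = c y x) ∧
      Disjoint R1 R2 ∧ Disjoint R1 B1 ∧ Disjoint R1 B2 ∧
      Disjoint R2 B1 ∧ Disjoint R2 B2 ∧ Disjoint B1 B2 ∧
      R1 ∪ R2 ∪ B1 ∪ B2 = Finset.univ ∧
      (R1.card = n / 4 ∨ R1.card = (n + 3) / 4) ∧
      (R2.card = n / 4 ∨ R2.card = (n + 3) / 4) ∧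
      (B1.card = n / 4 ∨ B1.card = (n + 3) / 4) ∧
      (B2.card = n / 4 ∨ B2.card = (n + 3) / 4) ∧
      (∀ x y, x ≠ y → (c x y = true ↔
        (x ∈ R1 ∧ y ∈ B1) ∨ (y ∈ R1 ∧ x ∈ B1) ∨
        (x ∈ B1 ∧ y ∈ B2) ∨ (y ∈ B1 ∧ x ∈ B2) ∨
        (x ∈ B2 ∧ y ∈ R2) ∨ (y ∈ B2 ∧ x ∈ R2))) ∧
      ∀ (col : Bool) (A : Finset (Fin n)), MonoDiamTwo c col A →
        (A ∩ R1 = ∅ ∨ A ∩ R2 = ∅ ∨ A ∩ B1 = ∅ ∨ A ∩ B2 = ∅) ∧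
        (A.card : ℤ) ≤ ⌈(3 * (n : ℚ)) / 4⌉ := by
  refine ⟨pathColoring n, residueClass n 0, residueClass n 3, residueClass n 1,
    residueClass n 2, fun x y => ?_, disjoint_residueClass (by norm_num),
    disjoint_residueClass (by norm_num), disjoint_residueClass (by norm_num),
    disjoint_residueClass (by norm_num), disjoint_residueClass (by norm_num),
    disjoint_residueClass (by norm_num), ?_, ?_, ?_, ?_, ?_, fun x y _ => ?_,
    fun col A hA => ?_⟩
  · simp only [pathColoring, or_comm]
  · ext x
    simp only [Finset.mem_union, mem_residueClass, Finset.mem_univ, iff_true]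
    omega
  · rw [card_residueClass (by norm_num)]; omega
  · rw [card_residueClass (by norm_num)]; omega
  · rw [card_residueClass (by norm_num)]; omega
  · rw [card_residueClass (by norm_num)]; omega
  · simp only [pathColoring, decide_eq_true_eq, mem_residueClass]
    omega
  · obtain ⟨r, hr, h⟩ := hA.exists_inter_residueClass_eq_empty
    refine ⟨?_, card_le_ceil_of_inter_residueClass_eq_empty hr h⟩
    interval_cases r <;> simp only [h, true_or, or_true]
end

section
/- Let the edges of the complete graph K_n be colored arbitrarily red or blue. Then no vertex x of K_n can be simultaneously red violated in K_n and blue violated in K_n. -/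
/-- `x, y` is a violated pair in color `col` (`true` = red, `false` = blue) for the
edge-two-coloring `c` of the complete graph on `Fin n`: `x ≠ y` and there is no path of
at most two edges, all of color `col`, joining `x` and `y`. -/
def IsViolatedPair {n : ℕ} (c : Fin n → Fin n → Bool) (col : Bool)
    (x y : Fin n) : Prop :=
  x ≠ y ∧ c x y ≠ col ∧
    ∀ z : Fin n, z ≠ x → z ≠ y → ¬(c x z = col ∧ c z y = col)

/-- `x` is a violated vertex in color `col` for the edge-two-coloring `c`. -/
def IsViolatedVertex {n : ℕ} (c : Fin n → Fin n → Bool) (col : Bool)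
    (x : Fin n) : Prop :=
  ∃ y : Fin n, IsViolatedPair c col x y

/-- For any red/blue coloring of the edges of `K_n`, no vertex is both red violated
and blue violated. -/
theorem stmt3 (n : ℕ) (c : Fin n → Fin n → Bool) (hc : ∀ x y, c x y = c y x)
    (x : Fin n) :
    ¬(IsViolatedVertex c true x ∧ IsViolatedVertex c false x) := by
  rintro ⟨⟨y, hxy, hcy, hy⟩, ⟨z, hxz, hcz, hz⟩⟩
  have hcy' : c x y = false := by simpa using hcy
  have hcz' : c x z = true := by simpa using hcz
  have hyz : y ≠ z := by
    rintro rfl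
    exact hcz hcy'
  cases h : c y z with
  | true => exact hy z hxz.symm hyz.symm ⟨hcz', (hc z y).trans h⟩
  | false => exact hz y hxy.symm hyz ⟨hcy', h⟩
end

section
/- Let the edges of the complete graph K_n be colored arbitrarily red or blue. If {w, x} is a red violated pair in K_n and y is a blue violated vertex in K_n, then the edges {w, y} and {x, y} have different colors. Symmetrically, if {w, x} is a blue violated pair in K_n and y is a red violated vertex in K_n, then the edges {w, y} and {x, y} have different colors. -/
/-- If `{w, x}` is a violated pair in one color and `y` is a violated vertex in the
other color, then the edges `{w, y}` and `{x, y}` have different colors.  (Taking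
`col = true` gives the red-pair/blue-vertex case and `col = false` the symmetric one.) -/
theorem stmt4 (n : ℕ) (c : Fin n → Fin n → Bool) (hc : ∀ x y, c x y = c y x)
    (col : Bool) (w x y : Fin n)
    (hwx : IsViolatedPair c col w x) (hy : IsViolatedVertex c (!col) y) :
    c w y ≠ c x y := by
  obtain ⟨hne, hwx, hpath⟩ := hwx
  obtain ⟨u, hyu, hcol, hypath⟩ := hy
  cases col <;> grind
end
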